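/- arXiv:math/0305319 — 2 statements merged into one kernel-verified Lean document; each statement's English description precedes it below -/
import Mathlib

section
/- For every n ≥ 1 and every r with 0 ≤ r ≤ n, the set of sequences with unit increase (a_0, a_1, ..., a_n) ending with a_n = r is in bijection with the set of sequences consisting of n terms equal to 1 and n−r terms equal to −1 all of whose partial sums are non-negative; in particular the two sets have the same cardinality. -/
/-- A sequence with unit increase: `a_0 = 0` and `a_{i+1} ≤ a_i + 1` for all `i`. -/
def UnitIncrease {n : ℕ} (a : Fin (n + 1) → ℕ) : Prop :=
  a 0 = 0 ∧ ∀ i : Fin n, a i.succ ≤ a i.castSucc + 1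

/-- Remove the last entry, when it is prescribed. -/
def snocSubtypeEquiv {α : Type} {L : ℕ} (P : (Fin (L + 1) → α) → Prop)
    (Q : (Fin L → α) → Prop) (x : α)
    (h : ∀ b : Fin L → α, P (Fin.snoc (α := fun _ => α) b x) ↔ Q b) :
    {b // P b ∧ b (Fin.last L) = x} ≃ {b // Q b} where
  toFun b := ⟨Fin.init (α := fun _ => α) b.1, by
    obtain ⟨b, h1, h2⟩ := b
    subst h2
    rw [← h, Fin.snoc_init_self]
    exact h1⟩
  invFun b := ⟨Fin.snoc (α := fun _ => α) b.1 x, (h _).2 b.2, by simp⟩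
  left_inv b := by
    obtain ⟨b, h1, h2⟩ := b
    subst h2
    apply Subtype.ext
    exact Fin.snoc_init_self _
  right_inv b := by
    apply Subtype.ext
    simp

/-- Split a subtype into two disjoint pieces. -/
theorem subtype_split {α : Type} {p q s : α → Prop} (h : ∀ a, p a ↔ q a ∨ s a)
    (hd : ∀ a, q a → s a → False) : Nonempty ({a // p a} ≃ {a // q a} ⊕ {a // s a}) := by
  classical
  refine ⟨(Equiv.subtypeEquivRight h).trans (subtypeOrEquiv q s ?_)⟩
  rw [Pi.disjoint_iff]
  intro a
  rw [Prop.disjoint_iff]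
  by_contra hc
  exact hd a (by tauto) (by tauto)

/-- Ballot sequences of length `L` with `n` ones. -/
def Ballot (L n : ℕ) (b : Fin L → ℤ) : Prop :=
  (∀ i, b i = 1 ∨ b i = -1) ∧
  (Finset.univ.filter (fun i => b i = 1)).card = n ∧
  ∀ k : Fin L, 0 ≤ ∑ j ∈ Finset.univ.filter (fun j => j ≤ k), b j

theorem unitIncrease_snoc {n : ℕ} (a : Fin (n + 1) → ℕ) (x : ℕ) :
    UnitIncrease (Fin.snoc (α := fun _ => ℕ) a x : Fin (n + 2) → ℕ) ↔
      UnitIncrease a ∧ x ≤ a (Fin.last n) + 1 := by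
  unfold UnitIncrease
  rw [Fin.forall_fin_succ']
  have h0 : (Fin.snoc (α := fun _ => ℕ) a x : Fin (n + 2) → ℕ) 0 = a 0 := by
    rw [← Fin.castSucc_zero, Fin.snoc_castSucc]
  rw [h0, Fin.succ_last, Fin.snoc_last, Fin.snoc_castSucc]
  simp only [← Fin.castSucc_succ, Fin.snoc_castSucc]
  tauto

theorem unitIncrease_le {n : ℕ} (a : Fin (n + 1) → ℕ) (h : UnitIncrease a) :
    ∀ i : Fin (n + 1), a i ≤ i := by
  intro i
  induction i using Fin.induction with
  | zero => simp [h.1]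
  | succ i ih =>
    have := h.2 i
    simp at ih ⊢
    omega

theorem sum_eq_card {L : ℕ} (b : Fin L → ℤ) (h : ∀ i, b i = 1 ∨ b i = -1) :
    ∑ i, b i = 2 * ((Finset.univ.filter (fun i => b i = 1)).card : ℤ) - L := by
  have : ∀ i, b i = 2 * (if b i = 1 then 1 else 0) - 1 := by
    intro i
    rcases h i with h | h <;> simp [h]
  rw [Finset.sum_congr rfl (fun i _ => this i), Finset.sum_sub_distrib, ← Finset.mul_sum]
  simp

theorem Ballot.total {L n : ℕ} {b : Fin L → ℤ} (h : Ballot L n b) : (L : ℤ) ≤ 2 * n := by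
  have h1 := sum_eq_card b h.1
  rw [h.2.1] at h1
  have : 0 ≤ ∑ i, b i := by
    cases L with
    | zero => simp
    | succ L =>
      have := h.2.2 (Fin.last L)
      simpa [Fin.le_last] using this
  omega

theorem ballot_snoc {L n m : ℕ} (x : ℤ) (hx : x = 1 ∨ x = -1)
    (hm : n = m + if x = 1 then 1 else 0) (hL : L + 1 ≤ 2 * n) (b : Fin L → ℤ) :
    Ballot (L + 1) n (Fin.snoc (α := fun _ => ℤ) b x) ↔ Ballot L m b := by
  have e1 : (∀ i, (Fin.snoc (α := fun _ => ℤ) b x : Fin (L + 1) → ℤ) i = 1 ∨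
      (Fin.snoc (α := fun _ => ℤ) b x : Fin (L + 1) → ℤ) i = -1) ↔
      ∀ i, b i = 1 ∨ b i = -1 := by
    rw [Fin.forall_fin_succ']
    simp only [Fin.snoc_castSucc, Fin.snoc_last]
    exact and_iff_left hx
  have e2 : (Finset.univ.filter
      (fun i => (Fin.snoc (α := fun _ => ℤ) b x : Fin (L + 1) → ℤ) i = 1)).card =
      (Finset.univ.filter (fun i => b i = 1)).card + if x = 1 then 1 else 0 := by
    simp only [Finset.card_filter]
    rw [Fin.sum_univ_castSucc]
    simp only [Fin.snoc_castSucc, Fin.snoc_last]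
  have e3 : ∀ k : Fin L, ∑ j ∈ Finset.univ.filter (fun j => j ≤ k.castSucc),
      (Fin.snoc (α := fun _ => ℤ) b x : Fin (L + 1) → ℤ) j =
      ∑ j ∈ Finset.univ.filter (fun j => j ≤ k), b j := by
    intro k
    simp only [Finset.sum_filter]
    rw [Fin.sum_univ_castSucc]
    simp only [Fin.snoc_castSucc, Fin.snoc_last, Fin.castSucc_le_castSucc_iff]
    have : ¬ Fin.last L ≤ k.castSucc := not_le.2 (Fin.castSucc_lt_last k)
    rw [if_neg this, add_zero]
  have e4 : ∑ j ∈ Finset.univ.filter (fun j => j ≤ Fin.last L),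
      (Fin.snoc (α := fun _ => ℤ) b x : Fin (L + 1) → ℤ) j =
      ∑ j, (Fin.snoc (α := fun _ => ℤ) b x : Fin (L + 1) → ℤ) j := by
    simp [Fin.le_last]
  unfold Ballot
  rw [e1, e2, Fin.forall_fin_succ', e4]
  simp only [e3]
  constructor
  · rintro ⟨h1, h2, h3, -⟩
    exact ⟨h1, by omega, h3⟩
  · rintro ⟨h1, h2, h3⟩
    refine ⟨h1, by omega, h3, ?_⟩
    rw [sum_eq_card _ (e1.2 h1), e2, h2, ← hm]
    push_cast
    omega

theorem ballot_equiv : ∀ L n r : ℕ, L + r = 2 * n →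
    Nonempty ({a : Fin (n + 1) → ℕ // UnitIncrease a ∧ a (Fin.last n) = r} ≃
      {b : Fin L → ℤ // Ballot L n b}) := by
  intro L
  induction L with
  | zero =>
    intro n r h
    rcases Nat.eq_zero_or_pos n with rfl | hn
    · obtain rfl : r = 0 := by omega
      refine ⟨⟨fun _ => ⟨fun i => i.elim0, fun i => i.elim0, by simp, fun i => i.elim0⟩,
        fun _ => ⟨fun _ => 0, ⟨rfl, fun i => i.elim0⟩, rfl⟩, ?_, ?_⟩⟩
      · rintro ⟨a, h1, h2⟩
        apply Subtype.ext
        funext i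
        obtain rfl : i = 0 := Fin.ext (by omega)
        exact h1.1.symm
      · rintro ⟨b, hb⟩
        apply Subtype.ext
        funext i
        exact i.elim0
    · have i1 : IsEmpty {a : Fin (n + 1) → ℕ // UnitIncrease a ∧ a (Fin.last n) = r} := by
        refine ⟨fun a => ?_⟩
        have := unitIncrease_le a.1 a.2.1 (Fin.last n)
        rw [a.2.2, Fin.val_last] at this
        omega
      have i2 : IsEmpty {b : Fin 0 → ℤ // Ballot 0 n b} := by
        refine ⟨fun b => ?_⟩
        have := b.2.2.1
        simp at this
        omega
      exact ⟨Equiv.equivOfIsEmpty _ _⟩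
  | succ L ih =>
    intro n r h
    obtain ⟨n, rfl⟩ : ∃ m, n = m + 1 := ⟨n - 1, by omega⟩
    -- the unit increase side
    have eA : ∀ r, Nonempty
        ({a : Fin (n + 2) → ℕ // UnitIncrease a ∧ a (Fin.last (n + 1)) = r} ≃
        {a : Fin (n + 1) → ℕ // UnitIncrease a ∧ r ≤ a (Fin.last n) + 1}) := fun r =>
      ⟨snocSubtypeEquiv _ _ r (fun b => unitIncrease_snoc b r)⟩
    -- the ballot side
    obtain ⟨eB⟩ := subtype_split (α := Fin (L + 1) → ℤ) (p := Ballot (L + 1) (n + 1))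
      (q := fun b => Ballot (L + 1) (n + 1) b ∧ b (Fin.last L) = 1)
      (s := fun b => Ballot (L + 1) (n + 1) b ∧ b (Fin.last L) = -1)
      (fun b => ⟨fun hb => (hb.1 (Fin.last L)).imp (fun h => ⟨hb, h⟩) (fun h => ⟨hb, h⟩),
        fun hb => hb.elim And.left And.left⟩)
      (fun b h1 h2 => by have := h1.2; have := h2.2; omega)
    have eB1 := snocSubtypeEquiv _ _ 1 (ballot_snoc (L := L) (n := n + 1) (m := n) 1
      (Or.inl rfl) (by simp) (by omega))
    have eB2 := snocSubtypeEquiv _ _ (-1) (ballot_snoc (L := L) (n := n + 1) (m := n + 1) (-1)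
      (Or.inr rfl) (by simp) (by omega))
    have eB' := eB.trans (Equiv.sumCongr eB1 eB2)
    obtain ⟨f⟩ := ih (n + 1) (r + 1) (by omega)
    obtain ⟨g⟩ := eA (r + 1)
    obtain ⟨g'⟩ := eA r
    cases r with
    | zero =>
      have : IsEmpty {b : Fin L → ℤ // Ballot L n b} := by
        refine ⟨fun b => ?_⟩
        have := b.2.total
        omega
      have e : {a : Fin (n + 1) → ℕ // UnitIncrease a ∧ 0 ≤ a (Fin.last n) + 1} ≃
          {a : Fin (n + 1) → ℕ // UnitIncrease a ∧ 0 + 1 ≤ a (Fin.last n) + 1} :=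
        Equiv.subtypeEquivRight (fun a => by simp)
      exact ⟨(g'.trans (e.trans (g.symm.trans f))).trans
        ((Equiv.emptySum _ _).symm.trans eB'.symm)⟩
    | succ r =>
      obtain ⟨f'⟩ := ih n r (by omega)
      obtain ⟨e⟩ := subtype_split (α := Fin (n + 1) → ℕ)
        (p := fun a => UnitIncrease a ∧ r + 1 ≤ a (Fin.last n) + 1)
        (q := fun a => UnitIncrease a ∧ a (Fin.last n) = r)
        (s := fun a => UnitIncrease a ∧ r + 1 + 1 ≤ a (Fin.last n) + 1)
        (fun a => by
          rw [← and_or_left]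
          exact and_congr_right (fun _ => by omega))
        (fun a h1 h2 => by have := h1.2; have := h2.2; omega)
      exact ⟨(g'.trans e).trans ((Equiv.sumCongr f' (g.symm.trans f)).trans eB'.symm)⟩

/-- For every `n ≥ 1` and `0 ≤ r ≤ n`, the set of sequences with
unit increase `(a_0, …, a_n)` ending with `a_n = r` is in bijection with the set of
sequences of `n` ones and `n − r` negative ones all of whose partial sums are
non-negative; in particular the two sets have the same cardinality. -/
theorem stmt11 (n r : ℕ) (hn : 1 ≤ n) (hr : r ≤ n) :
    Nonempty
      ({a : Fin (n + 1) → ℕ // UnitIncrease a ∧ a (Fin.last n) = r} ≃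
       {b : Fin (2 * n - r) → ℤ //
          (∀ i, b i = 1 ∨ b i = -1) ∧
          (Finset.univ.filter (fun i => b i = 1)).card = n ∧
          ∀ k : Fin (2 * n - r), 0 ≤ ∑ j ∈ Finset.univ.filter (fun j => j ≤ k), b j}) ∧
    Nat.card {a : Fin (n + 1) → ℕ // UnitIncrease a ∧ a (Fin.last n) = r} =
      Nat.card {b : Fin (2 * n - r) → ℤ //
          (∀ i, b i = 1 ∨ b i = -1) ∧
          (Finset.univ.filter (fun i => b i = 1)).card = n ∧
          ∀ k : Fin (2 * n - r), 0 ≤ ∑ j ∈ Finset.univ.filter (fun j => j ≤ k), b j} := by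
  have h := ballot_equiv (2 * n - r) n r (by omega)
  exact ⟨h, Nat.card_congr h.some⟩
end

section
/- The number of sequences with unit increase of length n+1, i.e., sequences (a_0, a_1, ..., a_n) of natural numbers with a_0 = 0 and a_{i+1} ≤ a_i + 1 for all i, is equal to the (n+1)-st Catalan number c_{n+1}. -/
/-- Number of unit-increase sequences with `n` steps starting at `k`, recursively. -/
def cntF : ℕ → ℕ → ℕ
  | 0, _ => 1
  | n + 1, k => ∑ j ∈ Finset.range (k + 2), cntF n j

theorem cntF_closed (n : ℕ) : ∀ k : ℕ,
    cntF (n + 1) k + (2 * n + k + 3).choose n = (2 * n + k + 3).choose (n + 1) := by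
  induction n with
  | zero => intro k; simp [cntF]
  | succ m ih =>
    intro k
    induction k with
    | zero =>
      have h0 := ih 0
      have h1 := ih 1
      have e : cntF (m + 1 + 1) 0 = cntF (m + 1) 0 + cntF (m + 1) 1 := by
        rw [cntF]; simp [Finset.sum_range_succ]
      rw [e]
      have s : (2 * m + 3).choose (m + 1) = (2 * m + 3).choose (m + 2) :=
        Nat.choose_symm_of_eq_add (by omega)
      have p1 : (2 * m + 5).choose (m + 2)
        = (2 * m + 4).choose (m + 1) + (2 * m + 4).choose (m + 2) := Nat.choose_succ_succ _ _
      have p2 : (2 * m + 5).choose (m + 1)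
        = (2 * m + 4).choose m + (2 * m + 4).choose (m + 1) := Nat.choose_succ_succ _ _
      have p3 : (2 * m + 4).choose (m + 2)
        = (2 * m + 3).choose (m + 1) + (2 * m + 3).choose (m + 2) := Nat.choose_succ_succ _ _
      have p4 : (2 * m + 4).choose (m + 1)
        = (2 * m + 3).choose m + (2 * m + 3).choose (m + 1) := Nat.choose_succ_succ _ _
      rw [show 2 * (m + 1) + 0 + 3 = 2 * m + 5 by ring]
      rw [show 2 * m + 0 + 3 = 2 * m + 3 by ring] at h0
      rw [show 2 * m + 1 + 3 = 2 * m + 4 by ring] at h1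
      rw [show m + 1 + 1 = m + 2 by ring]
      omega
    | succ k ihk =>
      have h := ih (k + 2)
      have e : cntF (m + 1 + 1) (k + 1) = cntF (m + 1 + 1) k + cntF (m + 1) (k + 2) := by
        exact Finset.sum_range_succ (fun j => cntF (m + 1) j) (k + 2)
      rw [e]
      have p1 : (2 * m + k + 6).choose (m + 2)
        = (2 * m + k + 5).choose (m + 1) + (2 * m + k + 5).choose (m + 2) :=
          Nat.choose_succ_succ _ _
      have p2 : (2 * m + k + 6).choose (m + 1)
        = (2 * m + k + 5).choose m + (2 * m + k + 5).choose (m + 1) := Nat.choose_succ_succ _ _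
      rw [show 2 * (m + 1) + (k + 1) + 3 = 2 * m + k + 6 by ring]
      rw [show 2 * m + (k + 2) + 3 = 2 * m + k + 5 by ring] at h
      rw [show 2 * (m + 1) + k + 3 = 2 * m + k + 5 by ring] at ihk
      rw [show m + 1 + 1 = m + 2 by ring] at *
      omega

theorem cntF_zero (n : ℕ) : cntF n 0 = catalan (n + 1) := by
  cases n with
  | zero => simp [cntF]
  | succ m =>
    have h := cntF_closed m 0
    rw [show 2 * m + 0 + 3 = 2 * m + 3 by ring] at h
    have c := succ_mul_catalan_eq_centralBinom (m + 2)
    rw [Nat.centralBinom, show 2 * (m + 2) = 2 * m + 3 + 1 by ring] at c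
    have p3 : (2 * m + 3 + 1).choose (m + 2)
        = (2 * m + 3).choose (m + 1) + (2 * m + 3).choose (m + 2) := Nat.choose_succ_succ _ _
    have s : (2 * m + 3).choose (m + 1) = (2 * m + 3).choose (m + 2) :=
        Nat.choose_symm_of_eq_add (by omega)
    have r := Nat.choose_succ_right_eq (2 * m + 3) m
    rw [show 2 * m + 3 - m = m + 3 by omega] at r
    show cntF (m + 1) 0 = catalan (m + 2)
    have : (m + 3) * cntF (m + 1) 0 = (m + 3) * catalan (m + 2) := by
      have h2 := congrArg (fun x => (m + 3) * x) h
      nlinarith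
    exact Nat.eq_of_mul_eq_mul_left (by omega) this

/-- Unit-increase sequences starting at `k`. -/
abbrev SeqFrom (n k : ℕ) : Type :=
  {a : Fin (n + 1) → ℕ // a 0 = k ∧ ∀ i : Fin n, a i.succ ≤ a i.castSucc + 1}

/-- Remove the first entry. -/
def seqFromEquiv (n k : ℕ) : SeqFrom (n + 1) k ≃ Σ j : Fin (k + 2), SeqFrom n j where
  toFun a := ⟨⟨a.1 1, by
      have h := a.2.2 0
      have h0 := a.2.1
      simp only [Fin.succ_zero_eq_one, Fin.castSucc_zero] at h
      omega⟩, ⟨fun i => a.1 i.succ, by simp, fun i => a.2.2 i.succ⟩⟩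
  invFun p := ⟨Fin.cons k p.2.1, by simp, by
    intro i
    refine Fin.cases ?_ (fun i => ?_) i
    · have h := p.2.2.1
      have := p.1.2
      simp only [Fin.cons_succ, Fin.castSucc_zero, Fin.cons_zero]
      omega
    · simpa only [Fin.cons_succ, ← Fin.succ_castSucc] using p.2.2.2 i⟩
  left_inv a := by
    apply Subtype.ext
    funext i
    refine Fin.cases ?_ (fun i => ?_) i
    · simp [a.2.1]
    · simp
  right_inv p := by
    obtain ⟨⟨j, hj⟩, ⟨b, hb, hb'⟩⟩ := p
    simp only at hb
    subst hb
    rfl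

theorem seqFrom_card (n : ℕ) : ∀ k, Finite (SeqFrom n k) ∧ Nat.card (SeqFrom n k) = cntF n k := by
  induction n with
  | zero =>
    intro k
    have : Unique (SeqFrom 0 k) :=
      { default := ⟨fun _ => k, rfl, fun i => i.elim0⟩
        uniq := fun a => by
          apply Subtype.ext
          funext i
          rw [show i = 0 from Fin.ext (by have := i.2; simp)]
          exact a.2.1 }
    exact ⟨inferInstance, by simp [cntF]⟩
  | succ n ih =>
    intro k
    have := fun j => (ih j).1
    refine ⟨Finite.of_equiv _ (seqFromEquiv n k).symm, ?_⟩
    rw [Nat.card_congr (seqFromEquiv n k), Nat.card_sigma, cntF, Finset.sum_range]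
    exact Finset.sum_congr rfl fun j _ => (ih j).2

/-- The number of sequences with unit increase of length `n+1`
is the `(n+1)`-st Catalan number. -/
theorem stmt12 (n : ℕ) :
    Nat.card {a : Fin (n + 1) → ℕ // UnitIncrease a} = catalan (n + 1) := by
  rw [← cntF_zero]
  exact (seqFrom_card n 0).2
end
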